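/- arXiv:1705.01800 — 8 statements merged into one kernel-verified Lean document; each statement's English description precedes it below -/
import Mathlib

section
/- For all positive integers n and r with n < r, the number N(n,r) of unlabeled (n,r)-bipartite graphs satisfies C(r + 2^n - 1, r) / n! ≤ N(n,r) ≤ 2 · C(r + 2^n - 1, r) / n!; equivalently, C(r + 2^n - 1, r) ≤ n! · N(n,r) ≤ 2 · C(r + 2^n - 1, r), where C(a,b) denotes the binomial coefficient. -/
/-- `numBip n r` is the number of orbits of the action of `S_n × S_r` on
`n × r` binary matrices `M : Fin n → Fin r → Bool`, where the pair `(α, β)`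
sends `M` to the matrix `(i, j) ↦ M (α⁻¹ i) (β⁻¹ j)`. -/
noncomputable def numBip (n r : ℕ) : ℕ :=
  Nat.card (Quot (fun M M' : Fin n → Fin r → Bool =>
    ∃ (α : Equiv.Perm (Fin n)) (β : Equiv.Perm (Fin r)),
      ∀ i j, M' i j = M (α⁻¹ i) (β⁻¹ j)))

open Finset Equiv

/-- The coefficients `r! [x ^ r] (1 - x) ^ (-f) (1 - x ^ 2) ^ (-(m - f) / 2)`, defined by their
two-term recursion. -/
def fixWeight (f m : ℕ) : ℕ → ℕ
  | 0 => 1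
  | 1 => f
  | r + 2 => f * fixWeight f m (r + 1) + (r + 1) * (m + r) * fixWeight f m r

lemma fixWeight_mono {f f' : ℕ} (h : f ≤ f') (m r : ℕ) : fixWeight f m r ≤ fixWeight f' m r := by
  induction r using Nat.twoStepInduction with
  | zero => simp [fixWeight]
  | one => simpa [fixWeight] using h
  | more r h0 h1 => simp only [fixWeight]; gcongr

lemma fixWeight_succ_le {f : ℕ} (hf : 1 ≤ f) (e r : ℕ) :
    fixWeight f (f + e) (r + 1) ≤ (f + e + r) * fixWeight f (f + e) r ∧
    (r + 1) * (f + e + r) * fixWeight f (f + e) r ≤ (e + r + 1) * fixWeight f (f + e) (r + 1) := by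
  obtain ⟨f, rfl⟩ := Nat.exists_eq_add_of_le' hf
  induction r with
  | zero =>
    simp only [fixWeight]
    constructor <;> nlinarith [Nat.zero_le (e * f)]
  | succ r ih =>
    obtain ⟨h1, h2⟩ := ih
    simp only [fixWeight]
    set a := fixWeight (f + 1) (f + 1 + e) r
    set b := fixWeight (f + 1) (f + 1 + e) (r + 1)
    refine ⟨by nlinarith, ?_⟩
    have h3 : (e + r + 2) * ((f + 1) * b + (r + 1) * b) ≤
        (e + r + 2) * ((f + 1) * b + (r + 1) * ((f + 1 + e + r) * a)) := by gcongr
    nlinarith [Nat.zero_le (e * f * b)]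

section Invariant

lemma Equiv.Perm.SameCycle.apply_eq_of_invariant {V β : Type*} [Finite V] {σ : Perm V} {c : V → β}
    (hc : ∀ v, c (σ v) = c v) {v w : V} (h : σ.SameCycle v w) : c w = c v := by
  obtain ⟨k, -, -, rfl⟩ := h.exists_pow_eq'
  induction k with
  | zero => rfl
  | succ k ih =>
    rw [pow_succ', Perm.mul_apply, hc]
    exact ih ⟨k, by simp⟩

variable {V : Type*} [Fintype V] [DecidableEq V]

/-- The multiplicity functions of multisets of size `r` in `V` that are invariant under `σ`. -/
def invAntidiag (σ : Perm V) (r : ℕ) : Finset (V → ℕ) :=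
  {c ∈ piAntidiag univ r | ∀ v, c (σ v) = c v}

lemma mem_invAntidiag {σ : Perm V} {r : ℕ} {c : V → ℕ} :
    c ∈ invAntidiag σ r ↔ ∑ v, c v = r ∧ ∀ v, c (σ v) = c v := by
  simp [invAntidiag]

lemma sum_invAntidiag_add_le {σ : Perm V} {z : V} (hz : σ z = z) (v : V) (r p : ℕ)
    (hp : p ≤ #{w | σ.SameCycle v w}) (hv : v = z → #{w | σ.SameCycle v w} = p) :
    ∑ c ∈ invAntidiag σ (r + p), c v ≤ ∑ c ∈ invAntidiag σ r, (c v + 1) := by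
  set ℓ := #{w | σ.SameCycle v w} with hℓ
  let g : (V → ℕ) → V → ℕ := fun c w =>
    c w - (if σ.SameCycle v w then 1 else 0) + (if w = z then ℓ - p else 0)
  have hg : ∀ c ∈ {c ∈ invAntidiag σ (r + p) | c v ≠ 0}, ∀ w,
      g c w + (if σ.SameCycle v w then 1 else 0) = c w + (if w = z then ℓ - p else 0) := by
    intro c hc w
    simp only [mem_filter, mem_invAntidiag] at hc
    by_cases h : σ.SameCycle v w
    · have := h.apply_eq_of_invariant hc.1.2
      simp only [g, h, if_true]
      omega
    · simp [g, h]
  have hgv : ∀ c ∈ {c ∈ invAntidiag σ (r + p) | c v ≠ 0}, g c v + 1 = c v := by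
    intro c hc
    have h := hg c hc v
    rw [if_pos (Perm.SameCycle.refl σ v)] at h
    split_ifs at h with h'
    · have := hv h'
      omega
    · omega
  have hinj : Set.InjOn g ({c ∈ invAntidiag σ (r + p) | c v ≠ 0} : Finset (V → ℕ)) := by
    intro c hc c' hc' h
    ext w
    have h1 := hg c hc w
    have h2 := hg c' hc' w
    rw [h] at h1
    omega
  have himg : image g {c ∈ invAntidiag σ (r + p) | c v ≠ 0} ⊆ invAntidiag σ r := by
    intro c' hc'
    obtain ⟨c, hc, rfl⟩ := mem_image.1 hc'
    have hs := Finset.sum_congr rfl fun w (_ : w ∈ univ) => hg c hc w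
    simp only [sum_add_distrib, sum_boole, sum_ite_eq', mem_univ, if_true] at hs
    simp only [mem_filter, mem_invAntidiag] at hc
    rw [hc.1.1, ← hℓ] at hs
    simp only [Nat.cast_id] at hs
    refine mem_invAntidiag.2 ⟨by omega, fun w => ?_⟩
    have : σ w = z ↔ w = z := by rw [← σ.injective.eq_iff (a := w), hz]
    simp [g, hc.1.2, this]
  calc ∑ c ∈ invAntidiag σ (r + p), c v
      = ∑ c ∈ invAntidiag σ (r + p) with c v ≠ 0, c v := (sum_filter_ne_zero _).symm
    _ = ∑ c ∈ invAntidiag σ (r + p) with c v ≠ 0, (g c v + 1) :=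
        sum_congr rfl fun c hc => (hgv c hc).symm
    _ = ∑ c ∈ image g {c ∈ invAntidiag σ (r + p) | c v ≠ 0}, (c v + 1) :=
        (sum_image (f := fun c => c v + 1) hinj).symm
    _ ≤ _ := sum_le_sum_of_subset himg

lemma sum_sum_invAntidiag (σ : Perm V) (r : ℕ) :
    ∑ v, ∑ c ∈ invAntidiag σ r, c v = r * #(invAntidiag σ r) := by
  rw [sum_comm, sum_congr rfl fun c hc => (mem_invAntidiag.1 hc).1]
  simp [mul_comm]

lemma sum_invAntidiag_succ_le {σ : Perm V} {v : V} (hv : σ v = v) (r : ℕ) :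
    ∑ c ∈ invAntidiag σ (r + 1), c v ≤ ∑ c ∈ invAntidiag σ r, c v + #(invAntidiag σ r) := by
  have h : #{w | σ.SameCycle v w} = 1 := by
    refine card_eq_one.2 ⟨v, ?_⟩
    ext w
    simp only [mem_filter, mem_univ, true_and, mem_singleton]
    exact ⟨fun h => (h.eq_of_left hv).symm, fun h => h ▸ Perm.SameCycle.refl _ _⟩
  simpa [sum_add_distrib] using sum_invAntidiag_add_le hv v r 1 h.ge fun _ => h

lemma sum_invAntidiag_add_two_le {σ : Perm V} {z : V} (hz : σ z = z) {v : V} (hv : σ v ≠ v)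
    (r : ℕ) :
    ∑ c ∈ invAntidiag σ (r + 2), c v ≤ ∑ c ∈ invAntidiag σ r, c v + #(invAntidiag σ r) := by
  have h : 2 ≤ #{w | σ.SameCycle v w} := by
    rw [← card_pair hv.symm]
    refine card_le_card fun w hw => ?_
    rcases mem_insert.1 hw with rfl | hw
    · simp [Perm.SameCycle.refl]
    · rw [mem_singleton] at hw
      simp [hw, Perm.SameCycle.refl]
  simpa [sum_add_distrib] using
    sum_invAntidiag_add_le hz v r 2 h fun h' => absurd (h' ▸ hz) hv

lemma card_invAntidiag_add_two_le {σ : Perm V} {z : V} (hz : σ z = z) (r : ℕ) :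
    (r + 2) * #(invAntidiag σ (r + 2)) ≤ #{v | σ v = v} * #(invAntidiag σ (r + 1)) +
      (Fintype.card V + r) * #(invAntidiag σ r) := by
  have key : ∀ v, ∑ c ∈ invAntidiag σ (r + 2), c v ≤ ∑ c ∈ invAntidiag σ r, c v +
      #(invAntidiag σ r) + (if σ v = v then #(invAntidiag σ (r + 1)) else 0) := by
    intro v
    split_ifs with h
    · have h1 := sum_invAntidiag_succ_le h r
      have h2 : ∑ c ∈ invAntidiag σ (r + 2), c v ≤ _ := sum_invAntidiag_succ_le h (r + 1)
      omega
    · exact sum_invAntidiag_add_two_le hz h r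
  have := sum_le_sum fun v (_ : v ∈ univ) => key v
  rw [sum_sum_invAntidiag, sum_add_distrib, sum_add_distrib, sum_sum_invAntidiag, ← sum_filter,
    sum_const, sum_const, card_univ, smul_eq_mul, smul_eq_mul] at this
  linarith

lemma card_invAntidiag_zero (σ : Perm V) : #(invAntidiag σ 0) = 1 := by
  refine card_eq_one.2 ⟨0, ?_⟩
  ext c
  simp only [mem_invAntidiag, sum_eq_zero_iff, mem_univ, true_implies, mem_singleton]
  exact ⟨fun h => funext h.1, fun h => by simp [h]⟩

lemma card_invAntidiag_one_le (σ : Perm V) : #(invAntidiag σ 1) ≤ #{v | σ v = v} := by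
  have key : ∀ v, ∑ c ∈ invAntidiag σ 1, c v ≤ if σ v = v then 1 else 0 := by
    intro v
    split_ifs with h
    · have h0 : ∀ c ∈ invAntidiag σ 0, c v = 0 := fun c hc => by
        have := (mem_invAntidiag.1 hc).1
        simp_all
      simpa [sum_eq_zero h0, card_invAntidiag_zero] using sum_invAntidiag_succ_le h 0
    · refine (sum_eq_zero fun c hc => ?_).le
      obtain ⟨h1, h2⟩ := mem_invAntidiag.1 hc
      have := sum_le_sum_of_subset (f := c) (subset_univ {v, σ v})
      rw [sum_pair (Ne.symm h), h1, h2] at this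
      omega
  have := sum_le_sum fun v (_ : v ∈ univ) => key v
  rwa [sum_sum_invAntidiag, one_mul, sum_boole, Nat.cast_id] at this

lemma factorial_mul_card_invAntidiag_le {σ : Perm V} {z : V} (hz : σ z = z) (r : ℕ) :
    r.factorial * #(invAntidiag σ r) ≤ fixWeight #{v | σ v = v} (Fintype.card V) r := by
  induction r using Nat.twoStepInduction with
  | zero => simp [fixWeight, card_invAntidiag_zero]
  | one => simpa [fixWeight] using card_invAntidiag_one_le σ
  | more r h0 h1 =>
    calc (r + 2).factorial * #(invAntidiag σ (r + 2))
        = (r + 1).factorial * ((r + 2) * #(invAntidiag σ (r + 2))) := by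
          rw [Nat.factorial_succ (r + 1)]; ring
      _ ≤ (r + 1).factorial * (#{v | σ v = v} * #(invAntidiag σ (r + 1)) +
          (Fintype.card V + r) * #(invAntidiag σ r)) := by
          gcongr; exact card_invAntidiag_add_two_le hz r
      _ = #{v | σ v = v} * ((r + 1).factorial * #(invAntidiag σ (r + 1))) +
          (r + 1) * (Fintype.card V + r) * (r.factorial * #(invAntidiag σ r)) := by
          rw [Nat.factorial_succ r]; ring
      _ ≤ _ := by rw [fixWeight]; gcongr

lemma card_invAntidiag_one_perm (r : ℕ) :
    #(invAntidiag (1 : Perm V) r) = (Fintype.card V + r - 1).choose r := by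
  have h : invAntidiag (1 : Perm V) r = piAntidiag univ r := by simp [invAntidiag]
  rw [h, ← map_sym_eq_piAntidiag, card_map, sym_univ, card_univ, Sym.card_sym_eq_choose]

end Invariant

lemma fixWeight_mul_ascFactorial_le {f m : ℕ} (hf : 1 ≤ f) (hfm : f ≤ m) {r s : ℕ} (h : r ≤ s) :
    fixWeight f m s * m.ascFactorial r ≤ fixWeight f m r * m.ascFactorial s := by
  obtain ⟨e, rfl⟩ := Nat.exists_eq_add_of_le hfm
  induction s, h using Nat.le_induction with
  | base => rfl
  | succ s _ ih =>
    rw [Nat.ascFactorial_succ]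
    calc _ ≤ (f + e + s) * fixWeight f (f + e) s * (f + e).ascFactorial r := by
          gcongr; exact (fixWeight_succ_le hf e s).1
      _ = (f + e + s) * (fixWeight f (f + e) s * (f + e).ascFactorial r) := by ring
      _ ≤ (f + e + s) * (fixWeight f (f + e) r * (f + e).ascFactorial s) := by gcongr
      _ = _ := by ring

lemma fixWeight_le_pow_mul {f m N : ℕ} {ρ : ℝ} (hρ : 0 < ρ) (h1 : f ≤ m * ρ)
    (h2 : f * ρ + N ≤ m * ρ ^ 2) (s : ℕ) (hs : s ≤ N + 1) :
    (fixWeight f m s : ℝ) ≤ ρ ^ s * m.ascFactorial s := by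
  induction s using Nat.twoStepInduction with
  | zero => simp [fixWeight]
  | one => simpa [fixWeight, mul_comm, Nat.ascFactorial_succ] using h1
  | more s ih0 ih1 =>
    have ih0 := ih0 (by omega)
    have ih1 := ih1 (by omega)
    have hsN : (s : ℝ) + 1 ≤ N := by exact_mod_cast (by omega : s + 1 ≤ N)
    simp only [fixWeight, Nat.cast_add, Nat.cast_mul, Nat.cast_one]
    calc (f : ℝ) * fixWeight f m (s + 1) + (s + 1) * (m + s) * fixWeight f m s
        ≤ f * (ρ ^ (s + 1) * m.ascFactorial (s + 1)) +
          (s + 1) * (m + s) * (ρ ^ s * m.ascFactorial s) := by gcongr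
      _ = ρ ^ s * m.ascFactorial (s + 1) * (f * ρ + (s + 1)) := by
          rw [Nat.ascFactorial_succ]; push_cast; ring
      _ ≤ ρ ^ s * m.ascFactorial (s + 1) * ((m + (s + 1)) * ρ ^ 2) := by
          gcongr
          nlinarith [sq_nonneg ρ]
      _ = _ := by rw [Nat.ascFactorial_succ (k := s + 1)]; push_cast; ring

lemma numDerangements_le_factorial (k : ℕ) : numDerangements k ≤ k.factorial := by
  induction k using Nat.twoStepInduction with
  | zero => simp
  | one => simp
  | more k h0 h1 =>
    rw [numDerangements_add_two]
    calc _ ≤ (k + 1) * (k.factorial + (k + 1).factorial) := by gcongr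
      _ = _ := by simp only [Nat.factorial_succ]; ring

lemma choose_mul_numDerangements_le (n k : ℕ) : n.choose k * numDerangements k ≤ n ^ k := by
  calc _ ≤ n.choose k * k.factorial := by gcongr; exact numDerangements_le_factorial k
    _ = n.descFactorial k := by rw [Nat.descFactorial_eq_factorial_mul_choose, mul_comm]
    _ ≤ _ := Nat.descFactorial_le_pow n k

/-- An upper bound for `r!` times the number of multisets of `r` columns fixed by a permutation
of the rows that moves `k` rows; it vanishes for `k = 0`. -/
def supportWeight (n r k : ℕ) : ℕ :=
  if k = 0 then 0 else fixWeight (2 ^ (n - (k + 1) / 2)) (2 ^ n) r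

lemma four_mul_sq_mul_pow_le {n : ℕ} (hn : 17 ≤ n) : 4 * (n : ℝ) ^ 2 * (2 / 3) ^ (n + 1) ≤ 1 := by
  induction n, hn using Nat.le_induction with
  | base => norm_num
  | succ n hn ih =>
    refine le_trans ?_ ih
    rw [pow_succ (2 / 3 : ℝ) (n + 1)]
    have : (17 : ℝ) ≤ n := by exact_mod_cast hn
    push_cast
    have h : 4 * ((n : ℝ) + 1) ^ 2 * (2 / 3) ≤ 4 * n ^ 2 := by nlinarith
    nlinarith [mul_le_mul_of_nonneg_right h (by positivity : (0 : ℝ) ≤ (2 / 3) ^ (n + 1))]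

lemma six_mul_le_pow {n : ℕ} (hn : 17 ≤ n) : 6 * (n : ℝ) ≤ (4 / 3) ^ n := by
  induction n, hn using Nat.le_induction with
  | base => norm_num
  | succ n hn ih =>
    have : (17 : ℝ) ≤ n := by exact_mod_cast hn
    rw [pow_succ]
    push_cast
    linarith

lemma fixWeight_two_pow_le {n d : ℕ} (hn : 17 ≤ n) (hd : 1 ≤ d) (hdn : 2 * d ≤ n + 1) :
    (fixWeight (2 ^ (n - d)) (2 ^ n) (n + 1) : ℝ) ≤
      ((2 / 3) ^ d) ^ (n + 1) * (2 ^ n).ascFactorial (n + 1) := by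
  have hf : ((2 ^ (n - d) : ℕ) : ℝ) = 2 ^ n * (1 / 2) ^ d := by
    rw [Nat.cast_pow, Nat.cast_ofNat, pow_sub₀ _ (by norm_num) (by omega)]
    simp
  refine fixWeight_le_pow_mul (N := n) (by positivity) ?_ ?_ (n + 1) le_rfl
  · rw [hf]
    push_cast
    gcongr _ * ?_
    exact pow_le_pow_left₀ (by norm_num) (by norm_num) d
  · rw [hf, mul_assoc, ← mul_pow, ← pow_mul, mul_comm d 2]
    push_cast
    have h1 : (1 / 2 * (2 / 3) : ℝ) ^ d ≤ 3 / 4 * (2 / 3) ^ (2 * d) := by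
      calc (1 / 2 * (2 / 3) : ℝ) ^ d = (3 / 4) ^ d * (2 / 3) ^ (2 * d) := by
            rw [pow_mul, ← mul_pow]; norm_num
        _ ≤ (3 / 4) ^ 1 * (2 / 3) ^ (2 * d) := by
            gcongr ?_ * _
            exact pow_le_pow_of_le_one (by norm_num) (by norm_num) hd
        _ = _ := by rw [pow_one]
    have h2 : 4 * (n : ℝ) ≤ 2 ^ n * (2 / 3) ^ (2 * d) := by
      calc 4 * (n : ℝ) ≤ 2 / 3 * (4 / 3) ^ n := by linarith [six_mul_le_pow hn]
        _ = 2 ^ n * (2 / 3) ^ (n + 1) := by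
            rw [pow_succ, ← mul_assoc, ← mul_pow]; norm_num [mul_comm]
        _ ≤ _ := by
            gcongr _ * ?_
            exact pow_le_pow_of_le_one (by norm_num) (by norm_num) hdn
    have h3 := mul_le_mul_of_nonneg_left h1 (by positivity : (0 : ℝ) ≤ 2 ^ n)
    linarith

lemma choose_mul_supportWeight_le {n k : ℕ} (hn : 17 ≤ n) (hk : 1 ≤ k) (hkn : k ≤ n) :
    (n.choose k * (numDerangements k * supportWeight n (n + 1) k) : ℝ) ≤
      (1 / 2) ^ k * (2 ^ n).ascFactorial (n + 1) := by
  have hn0 : (0 : ℝ) < n := by exact_mod_cast (by omega : 0 < n)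
  have h1 : (n.choose k * numDerangements k : ℝ) ≤ n ^ k := by
    exact_mod_cast choose_mul_numDerangements_le n k
  have h2 := fixWeight_two_pow_le hn (d := (k + 1) / 2) (by omega) (by omega)
  have h3 : (((2 / 3) ^ ((k + 1) / 2)) ^ (n + 1) : ℝ) ≤ (1 / (2 * n)) ^ k := by
    calc (((2 / 3) ^ ((k + 1) / 2)) ^ (n + 1) : ℝ)
        = ((2 / 3) ^ (n + 1)) ^ ((k + 1) / 2) := by rw [← pow_mul, ← pow_mul, mul_comm]
      _ ≤ ((1 / (2 * n)) ^ 2) ^ ((k + 1) / 2) := by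
          gcongr
          rw [one_div_pow, le_div_iff₀ (by positivity)]
          linarith [four_mul_sq_mul_pow_le hn]
      _ = (1 / (2 * n)) ^ (2 * ((k + 1) / 2)) := by rw [← pow_mul]
      _ ≤ _ := by
          refine pow_le_pow_of_le_one (by positivity) ?_ (by omega)
          rw [div_le_one (by positivity)]
          have : (17 : ℝ) ≤ n := by exact_mod_cast hn
          linarith
  rw [supportWeight, if_neg (by omega), ← mul_assoc]
  calc _ ≤ (n : ℝ) ^ k * ((1 / (2 * n)) ^ k * (2 ^ n).ascFactorial (n + 1)) := by
        gcongr
        exact h2.trans (by gcongr)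
    _ = _ := by
        rw [← mul_assoc, ← mul_pow]
        congr 2
        field_simp

lemma sum_supportWeight_le (n : ℕ) :
    ∑ k ∈ range (n + 1), n.choose k * (numDerangements k * supportWeight n (n + 1) k) ≤
      (2 ^ n).ascFactorial (n + 1) := by
  rcases lt_or_ge n 17 with hn | hn
  · revert n
    decide +kernel
  · have key : (∑ k ∈ range (n + 1),
        n.choose k * (numDerangements k * supportWeight n (n + 1) k) : ℝ) ≤
        (2 ^ n).ascFactorial (n + 1) := by
      rw [sum_range_succ']
      calc _ = ∑ k ∈ range n, (n.choose (k + 1) *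
              (numDerangements (k + 1) * supportWeight n (n + 1) (k + 1)) : ℝ) := by
            simp [supportWeight]
        _ ≤ ∑ k ∈ range n, (1 / 2) ^ (k + 1) * ((2 ^ n).ascFactorial (n + 1) : ℝ) := by
            refine sum_le_sum fun k hk => ?_
            rw [mem_range] at hk
            exact choose_mul_supportWeight_le hn (by omega) (by omega)
        _ = (1 - (1 / 2) ^ n) * ((2 ^ n).ascFactorial (n + 1) : ℝ) := by
            rw [← sum_mul]
            congr 1
            simp_rw [pow_succ, ← sum_mul]
            rw [geom_sum_eq (by norm_num)]
            ring
        _ ≤ _ := by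
            refine mul_le_of_le_one_left (by positivity) ?_
            linarith [show (0 : ℝ) ≤ (1 / 2) ^ n by positivity]
    exact_mod_cast key

section Rows

/-- The action of a permutation of the rows on the possible columns. -/
def columnPerm {ι : Type*} (α : Perm ι) : Perm (ι → Bool) := α.symm.arrowCongr (Equiv.refl Bool)

lemma columnPerm_apply {ι : Type*} (α : Perm ι) (v : ι → Bool) : columnPerm α v = v ∘ α := by
  ext i; simp [columnPerm]

variable {ι : Type*} [Fintype ι] [DecidableEq ι]

lemma card_support_eq_numDerangements (s : Finset ι) :
    #{α : Perm ι | α.support = s} = numDerangements #s := by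
  have e := derangements.subtypeEquiv (fun i : ι => i ∈ s)
  rw [← Fintype.card_coe s, ← card_derangements_eq_numDerangements, Fintype.card_congr e,
    Fintype.card_subtype]
  congr 1
  ext α
  simp only [mem_filter, mem_univ, true_and, Finset.ext_iff, Perm.mem_support,
    Function.mem_fixedPoints, Function.IsFixedPt]
  exact forall_congr' fun i => by tauto

lemma sum_card_support (G : ℕ → ℕ) :
    ∑ α : Perm ι, G #α.support = ∑ k ∈ range (Fintype.card ι + 1),
      (Fintype.card ι).choose k * (numDerangements k * G k) := by
  rw [← sum_fiberwise_of_maps_to (s := univ) (t := (univ : Finset ι).powerset)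
    (g := fun α : Perm ι => α.support) (fun _ _ => by simp)]
  have h : ∀ s ∈ (univ : Finset ι).powerset, ∑ α : Perm ι with α.support = s, G #α.support =
      numDerangements #s * G #s := by
    intro s _
    rw [sum_congr rfl fun α hα => by rw [(mem_filter.1 hα).2], sum_const,
      card_support_eq_numDerangements, smul_eq_mul]
  rw [sum_congr rfl h, sum_powerset_apply_card (fun k => numDerangements k * G k), card_univ]
  simp

lemma card_invariant_le (α : Perm ι) :
    #{v : ι → Bool | ∀ i, v (α i) = v i} ≤ 2 ^ (Fintype.card ι - (#α.support + 1) / 2) := by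
  let out : ι → ι := fun i => (Quotient.mk (Perm.SameCycle.setoid α) i).out
  have hout : ∀ i, α.SameCycle (out i) i := fun i =>
    Quotient.exact (s := Perm.SameCycle.setoid α) (Quotient.out_eq _)
  have hα : ∀ i, out (α i) = out i := fun i => by
    have : (Quotient.mk (Perm.SameCycle.setoid α) (α i)) = Quotient.mk _ i :=
      Quotient.sound (s := Perm.SameCycle.setoid α) (Perm.sameCycle_apply_left.2 (.refl _ _))
    simp only [out, this]
  let T : Finset ι := {i | out i = i}
  have hT : #T ≤ Fintype.card ι - (#α.support + 1) / 2 := by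
    have h1 : #(T ∩ α.support) ≤ #(α.support \ T) := by
      refine card_le_card_of_injOn α (fun i hi => ?_) α.injective.injOn
      simp only [T, coe_inter, Set.mem_inter_iff, mem_coe, mem_filter, mem_univ, true_and,
        Perm.mem_support] at hi
      simp only [T, mem_coe, mem_sdiff, Perm.mem_support, mem_filter, mem_univ, true_and, hα]
      exact ⟨fun h => hi.2 (α.injective h), fun h => hi.2 (h.symm.trans hi.1)⟩
    have h2 : #(α.support \ T) + #(T ∩ α.support) = #α.support := by
      rw [inter_comm, card_sdiff_add_card_inter]
    have h3 : #T ≤ #(T ∩ α.support) + #α.supportᶜ := by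
      rw [← card_inter_add_card_sdiff T α.support]
      gcongr
      exact fun i hi => by simpa using (mem_sdiff.1 hi).2
    rw [card_compl] at h3
    have h4 := card_le_univ α.support
    omega
  calc #{v : ι → Bool | ∀ i, v (α i) = v i}
      ≤ #(univ : Finset (T → Bool)) := by
        refine card_le_card_of_injOn (fun v i => v i) (by simp) fun v hv w hw h => ?_
        simp only [coe_filter, mem_univ, true_and, Set.mem_ofPred_eq] at hv hw
        have hi : ∀ i, out (out i) = out i := fun i => by
          simp only [out, Quotient.out_eq]
        ext i
        rw [(hout i).apply_eq_of_invariant hv, (hout i).apply_eq_of_invariant hw]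
        exact congrFun h ⟨out i, by simp [T, hi]⟩
    _ = 2 ^ #T := by simp
    _ ≤ _ := Nat.pow_le_pow_right (by norm_num) hT

instance columnMultisetAction (r : ℕ) :
    MulAction (Perm ι) {c : (ι → Bool) → ℕ // ∑ v, c v = r} where
  smul α c := ⟨fun v => c.1 (columnPerm α v), by rw [Equiv.sum_comp, c.2]⟩
  one_smul c := Subtype.ext (funext fun v => congrArg c.1 (columnPerm_apply 1 v))
  mul_smul α β c := Subtype.ext (funext fun v => congrArg c.1 (by
    simp only [columnPerm_apply]; rfl))

lemma columnMultiset_smul_apply {r : ℕ} (α : Perm ι)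
    (c : {c : (ι → Bool) → ℕ // ∑ v, c v = r}) (v : ι → Bool) :
    (α • c).1 v = c.1 (v ∘ α) := congrArg c.1 (columnPerm_apply α v)

lemma natCard_fixedBy (r : ℕ) (α : Perm ι) :
    Nat.card (MulAction.fixedBy {c : (ι → Bool) → ℕ // ∑ v, c v = r} α) =
      #(invAntidiag (columnPerm α) r) := by
  rw [← Nat.card_eq_finsetCard]
  have h : ∀ c : {c : (ι → Bool) → ℕ // ∑ v, c v = r},
      c ∈ MulAction.fixedBy _ α ↔ ∀ v, c.1 (columnPerm α v) = c.1 v := fun c => by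
    rw [MulAction.mem_fixedBy, Subtype.ext_iff, funext_iff]
    exact Iff.rfl
  exact Nat.card_congr
    { toFun := fun c => ⟨c.1.1, mem_invAntidiag.2 ⟨c.1.2, (h c.1).1 c.2⟩⟩
      invFun := fun c => ⟨⟨c.1, (mem_invAntidiag.1 c.2).1⟩, (h _).2 (mem_invAntidiag.1 c.2).2⟩ }

end Rows

/-- The multiset of columns of a binary matrix. -/
def columnCount {n r : ℕ} (M : Fin n → Fin r → Bool) :
    {c : (Fin n → Bool) → ℕ // ∑ v, c v = r} :=
  ⟨fun v => #{j | (fun i => M i j) = v}, by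
    rw [← card_eq_sum_card_fiberwise (fun _ _ => by simp)]; simp⟩

lemma columnCount_apply {n r : ℕ} (M : Fin n → Fin r → Bool) (v : Fin n → Bool) :
    (columnCount M).1 v = #{j | (fun i => M i j) = v} := rfl

lemma columnCount_surjective (n r : ℕ) : Function.Surjective (@columnCount n r) := by
  rintro ⟨c, hc⟩
  have hcard : Fintype.card (Σ v, Fin (c v)) = Fintype.card (Fin r) := by simp [hc]
  let e := Fintype.equivOfCardEq hcard
  refine ⟨fun i j => (e.symm j).1 i, Subtype.ext (funext fun v => ?_)⟩
  calc #{j : Fin r | (e.symm j).1 = v} = #{x : Σ v, Fin (c v) | x.1 = v} :=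
        card_equiv e.symm (by simp)
    _ = Fintype.card {x : Σ v, Fin (c v) // x.1 = v} := (Fintype.card_subtype _).symm
    _ = Fintype.card (Fin (c v)) := Fintype.card_congr (Equiv.sigmaSubtype v)
    _ = c v := Fintype.card_fin _

lemma columnCount_eq_iff {n r : ℕ} (M M' : Fin n → Fin r → Bool) :
    columnCount M' = columnCount M ↔ ∃ β : Perm (Fin r), ∀ i j, M' i j = M i (β⁻¹ j) := by
  constructor
  · intro h
    have hv : ∀ v, Nonempty ({j // (fun i => M' i j) = v} ≃ {j // (fun i => M i j) = v}) := by
      intro v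
      refine Fintype.card_eq.1 ?_
      rw [Fintype.card_subtype, Fintype.card_subtype]
      exact congrFun (congrArg Subtype.val h) v
    let e := Equiv.ofFiberEquiv fun v => (hv v).some
    refine ⟨e⁻¹, fun i j => ?_⟩
    rw [inv_inv]
    exact (congrFun (Equiv.ofFiberEquiv_map (fun v => (hv v).some) j) i).symm
  · rintro ⟨β, h⟩
    refine Subtype.ext (funext fun v => ?_)
    rw [columnCount_apply, columnCount_apply]
    exact card_equiv β⁻¹ fun j => by simp [h]

lemma columnCount_comp {n r : ℕ} (M : Fin n → Fin r → Bool) (α : Perm (Fin n)) :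
    columnCount (fun i j => M (α⁻¹ i) j) = α • columnCount M := by
  refine Subtype.ext (funext fun v => ?_)
  rw [columnMultiset_smul_apply, columnCount_apply, columnCount_apply]
  refine congrArg card (filter_congr fun j _ => ?_)
  constructor
  · rintro rfl; ext i; simp
  · intro h; ext i; simpa using congrFun h (α⁻¹ i)

lemma numBip_eq_card_orbits (n r : ℕ) :
    numBip n r = Nat.card (MulAction.orbitRel.Quotient (Perm (Fin n))
      {c : (Fin n → Bool) → ℕ // ∑ v, c v = r}) := by
  have hrel : ∀ M M' : Fin n → Fin r → Bool,
      (∃ (α : Perm (Fin n)) (β : Perm (Fin r)), ∀ i j, M' i j = M (α⁻¹ i) (β⁻¹ j)) ↔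
      ∃ α : Perm (Fin n), α • columnCount M = columnCount M' := by
    intro M M'
    refine exists_congr fun α => ?_
    rw [← columnCount_comp, eq_comm, columnCount_eq_iff]
  refine Nat.card_eq_of_bijective (Quot.lift
    (fun M => (Quotient.mk _ (columnCount M) : MulAction.orbitRel.Quotient (Perm (Fin n)) _))
    fun M M' h => (Quotient.sound ((hrel M M').1 h)).symm) ⟨?_, ?_⟩
  · rintro ⟨M⟩ ⟨M'⟩ h
    exact Quot.sound ((hrel M M').2 (Quotient.exact h.symm))
  · rintro ⟨c⟩
    obtain ⟨M, rfl⟩ := columnCount_surjective n r c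
    exact ⟨Quot.mk _ M, rfl⟩

lemma factorial_mul_numBip (n r : ℕ) :
    n.factorial * numBip n r = ∑ α : Perm (Fin n), #(invAntidiag (columnPerm α) r) := by
  classical
  have : Finite {c : (Fin n → Bool) → ℕ // ∑ v, c v = r} :=
    (piAntidiag univ r).finite_toSet.subset 
      (fun c (hc : ∑ v, c v = r) => by simpa using hc)
  have := Fintype.ofFinite {c : (Fin n → Bool) → ℕ // ∑ v, c v = r}
  have := Fintype.ofFinite (MulAction.orbitRel.Quotient (Perm (Fin n))
      {c : (Fin n → Bool) → ℕ // ∑ v, c v = r})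
  have h := MulAction.sum_card_fixedBy_eq_card_orbits_mul_card_group (Perm (Fin n))
    {c : (Fin n → Bool) → ℕ // ∑ v, c v = r}
  rw [Fintype.card_perm, Fintype.card_fin] at h
  rw [numBip_eq_card_orbits, mul_comm, Nat.card_eq_fintype_card, ← h]
  refine sum_congr rfl fun α _ => ?_
  rw [← natCard_fixedBy, Nat.card_eq_fintype_card]

lemma factorial_mul_card_invAntidiag_columnPerm_le {n : ℕ} (r : ℕ) {α : Perm (Fin n)}
    (hα : α ≠ 1) :
    r.factorial * #(invAntidiag (columnPerm α) r) ≤ supportWeight n r #α.support := by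
  rw [supportWeight, if_neg (by simpa using hα)]
  refine (factorial_mul_card_invAntidiag_le (z := fun _ => false)
    (columnPerm_apply α _) r).trans ?_
  have h : #{v | columnPerm α v = v} ≤ 2 ^ (n - (#α.support + 1) / 2) := by
    have h := card_invariant_le α
    rw [Fintype.card_fin] at h
    convert h using 4
    rw [columnPerm_apply, funext_iff]
    rfl
  simpa using fixWeight_mono h (2 ^ n) r

lemma supportWeight_mul_le {n : ℕ} (k : ℕ) {r s : ℕ} (h : r ≤ s) :
    supportWeight n s k * (2 ^ n).ascFactorial r ≤
      supportWeight n r k * (2 ^ n).ascFactorial s := by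
  unfold supportWeight
  split_ifs
  · simp
  · exact fixWeight_mul_ascFactorial_le Nat.one_le_two_pow
      (Nat.pow_le_pow_right (by norm_num) (Nat.sub_le _ _)) h

lemma sum_supportWeight_le_of_lt {n r : ℕ} (h : n < r) :
    ∑ α : Perm (Fin n), supportWeight n r #α.support ≤ (2 ^ n).ascFactorial r := by
  have hpos : 0 < (2 ^ n).ascFactorial (n + 1) := by
    obtain ⟨m, hm⟩ := Nat.exists_eq_add_of_le' (Nat.one_le_two_pow (n := n))
    rw [hm]
    exact Nat.ascFactorial_pos m _
  refine le_of_mul_le_mul_right ?_ hpos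
  calc (∑ α : Perm (Fin n), supportWeight n r #α.support) * (2 ^ n).ascFactorial (n + 1)
      ≤ (∑ α : Perm (Fin n), supportWeight n (n + 1) #α.support) *
        (2 ^ n).ascFactorial r := by
        rw [sum_mul, sum_mul]
        exact sum_le_sum fun α _ => supportWeight_mul_le _ h
    _ ≤ (2 ^ n).ascFactorial (n + 1) * (2 ^ n).ascFactorial r := by
        refine Nat.mul_le_mul_right _ ?_
        rw [sum_card_support (supportWeight n (n + 1)), Fintype.card_fin]
        exact sum_supportWeight_le n
    _ = (2 ^ n).ascFactorial r * (2 ^ n).ascFactorial (n + 1) := mul_comm _ _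

/-- For `0 < n < r`, the number of unlabeled `(n,r)`-bipartite graphs satisfies
`C(r + 2^n - 1, r) / n! ≤ N(n,r) ≤ 2 · C(r + 2^n - 1, r) / n!`, stated as
`C(r + 2^n - 1, r) ≤ n! · N(n,r) ≤ 2 · C(r + 2^n - 1, r)`. -/
theorem numBip_bounds (n r : ℕ) (hn : 0 < n) (hr : 0 < r) (hnr : n < r) :
    Nat.choose (r + 2 ^ n - 1) r ≤ Nat.factorial n * numBip n r ∧
    Nat.factorial n * numBip n r ≤ 2 * Nat.choose (r + 2 ^ n - 1) r := by
  have hone : #(invAntidiag (columnPerm (1 : Perm (Fin n))) r) = (r + 2 ^ n - 1).choose r := by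
    have : columnPerm (1 : Perm (Fin n)) = 1 := Equiv.ext fun v => columnPerm_apply 1 v
    rw [this, card_invAntidiag_one_perm, add_comm r]
    simp
  rw [factorial_mul_numBip, ← add_sum_erase _ _ (mem_univ (1 : Perm (Fin n))), hone, two_mul]
  refine ⟨Nat.le_add_right _ _, Nat.add_le_add_left ?_ _⟩
  refine Nat.le_of_mul_le_mul_left ?_ r.factorial_pos
  calc _ ≤ ∑ α ∈ univ.erase (1 : Perm (Fin n)), supportWeight n r #α.support := by
        rw [mul_sum]
        exact sum_le_sum fun α hα =>
          factorial_mul_card_invAntidiag_columnPerm_le r (ne_of_mem_erase hα)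
    _ ≤ ∑ α : Perm (Fin n), supportWeight n r #α.support :=
        sum_le_sum_of_subset (erase_subset _ _)
    _ ≤ _ := sum_supportWeight_le_of_lt hnr
    _ = _ := by rw [Nat.ascFactorial_eq_factorial_mul_choose', add_comm r]
end

section
/- For all positive integers n and r with n < r, the number N(n,r) of unlabeled (n,r)-bipartite graphs satisfies n! · N(n,r) ≥ C(r + 2^n - 1, r), where C(a,b) denotes the binomial coefficient. -/
/-- Relabelling the rows and columns of a binary matrix is an equivalence relation. -/
theorem equivalence_relabel (n r : ℕ) :
    Equivalence (fun M M' : Fin n → Fin r → Bool =>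
      ∃ (α : Equiv.Perm (Fin n)) (β : Equiv.Perm (Fin r)),
        ∀ i j, M' i j = M (α⁻¹ i) (β⁻¹ j)) where
  refl M := ⟨1, 1, by simp⟩
  symm := by
    rintro M M' ⟨α, β, h⟩
    exact ⟨α⁻¹, β⁻¹, by simp [h]⟩
  trans := by
    rintro M M' M'' ⟨α, β, h⟩ ⟨α', β', h'⟩
    exact ⟨α' * α, β' * β, by simp [h, h']⟩

/-- The multiset of columns of a binary matrix. -/
def colSym {n r : ℕ} (M : Fin n → Fin r → Bool) : Sym (Fin n → Bool) r :=
  ⟨Finset.univ.val.map (fun j i => M i j), by simp⟩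

theorem colSym_surjective (n r : ℕ) :
    Function.Surjective (colSym : (Fin n → Fin r → Bool) → Sym (Fin n → Bool) r) := by
  rintro ⟨s, rfl⟩
  induction s using Quotient.inductionOn with
  | h l => exact ⟨fun i j => l.get j i, Subtype.ext ((Fin.univ_val_map _).trans (by simp))⟩

theorem colSym_permute_columns {n r : ℕ} (M : Fin n → Fin r → Bool)
    (β : Equiv.Perm (Fin r)) : colSym (fun i j => M i (β j)) = colSym M := by
  apply Subtype.ext
  change Finset.univ.val.map ((fun j i => M i j) ∘ β) = Finset.univ.val.map (fun j i => M i j)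
  rw [← Multiset.map_map, Multiset.map_univ_val_equiv]

/-- For `0 < n < r`, `n! · N(n,r) ≥ C(r + 2^n - 1, r)`. -/
theorem numBip_lower_bound (n r : ℕ) (hn : 0 < n) (hr : 0 < r) (hnr : n < r) :
    Nat.choose (r + 2 ^ n - 1) r ≤ Nat.factorial n * numBip n r := by
  have hsym : Nat.card (Sym (Fin n → Bool) r) = Nat.choose (r + 2 ^ n - 1) r := by
    rw [Nat.card_eq_fintype_card, Sym.card_sym_eq_choose]
    simp [add_comm]
  have hperm : Nat.card (Equiv.Perm (Fin n)) = Nat.factorial n := by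
    rw [Nat.card_perm, Nat.card_fin]
  rw [← hsym, ← hperm, numBip, ← Nat.card_prod]
  refine Nat.card_le_card_of_surjective
    (fun p => colSym (fun i j => p.2.out (p.1⁻¹ i) j)) fun s => ?_
  obtain ⟨M, rfl⟩ := colSym_surjective n r s
  obtain ⟨α, β, h⟩ := (equivalence_relabel n r).quot_mk_eq_iff _ _ |>.mp
    (Quot.out_eq (Quot.mk (fun M M' : Fin n → Fin r → Bool =>
      ∃ (α : Equiv.Perm (Fin n)) (β : Equiv.Perm (Fin r)),
        ∀ i j, M' i j = M (α⁻¹ i) (β⁻¹ j)) M))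
  refine ⟨(α, Quot.mk _ M), ?_⟩
  refine (colSym_permute_columns _ β⁻¹).symm.trans (congrArg colSym ?_)
  funext i j
  exact (h i j).symm
end

section
/- For all positive integers n and r with r ≥ 1, the sum over all permutations β of Fin r of (2^n)^{c(β)} equals (r + 2^n - 1) times the sum over all permutations β of Fin (r-1) of (2^n)^{c(β)}, where c(β) is the number of cycles of β including fixed points. -/
/-- Orbit relation on `α` of the cyclic group generated by the permutation `σ`:
two points are related iff some power of `σ` maps one to the other. -/
def permOrbRel {α : Type*} (σ : Equiv.Perm α) (x y : α) : Prop :=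
  ∃ k : ℤ, (σ ^ k) x = y

/-- Number of cycles of a permutation, counting fixed points as cycles of length 1:
the number of orbits of the subgroup generated by `σ`. -/
noncomputable def cycleCount {α : Type*} (σ : Equiv.Perm α) : ℕ :=
  Nat.card (Quot (permOrbRel σ))

/-- The size (length) of a cycle of a permutation, viewed as an orbit class. -/
noncomputable def orbSize {α : Type*} {r : α → α → Prop} (q : Quot r) : ℕ :=
  Nat.card {x // Quot.mk r x = q}

theorem apply_eq_of_permOrbRel {α β : Type*} {σ : Equiv.Perm α} {f : α → β}
    (hf : ∀ x, f (σ x) = f x) {x y : α} (h : permOrbRel σ x y) : f x = f y := by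
  obtain ⟨k, rfl⟩ := h
  induction k with
  | zero => simp
  | succ k ih => rw [ih, add_comm, zpow_one_add, Equiv.Perm.mul_apply, hf]
  | pred k ih =>
    rw [ih, ← hf ((σ ^ (-(k : ℤ) - 1)) x), ← Equiv.Perm.mul_apply, ← zpow_one_add,
      add_sub_cancel]

theorem quot_mk_permOrbRel_apply {α : Type*} (σ : Equiv.Perm α) (x : α) :
    Quot.mk (permOrbRel σ) (σ x) = Quot.mk (permOrbRel σ) x :=
  (Quot.sound ⟨1, by simp⟩).symm

/-- Inserting a new point as a fixed point adds one cycle. -/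
theorem cycleCount_decomposeFin_symm_zero {n : ℕ} (e : Equiv.Perm (Fin n)) :
    cycleCount (Equiv.Perm.decomposeFin.symm (0, e)) = cycleCount e + 1 := by
  set σ := Equiv.Perm.decomposeFin.symm (0, e)
  have hz : σ 0 = 0 := Equiv.Perm.decomposeFin_symm_apply_zero 0 e
  have hs (x : Fin n) : σ x.succ = (e x).succ := by
    simp [σ, Equiv.Perm.decomposeFin_symm_apply_succ]
  let f : Fin (n + 1) → Option (Quot (permOrbRel e)) :=
    Fin.cases none fun x => some (Quot.mk _ x)
  have hf (x : Fin (n + 1)) : f (σ x) = f x := by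
    cases x using Fin.cases with
    | zero => rw [hz]
    | succ x => simp [hs, f, quot_mk_permOrbRel_apply]
  let g : Fin n → Quot (permOrbRel σ) := fun x => Quot.mk _ x.succ
  have hg (x : Fin n) : g (e x) = g x := by
    simp only [g, ← hs, quot_mk_permOrbRel_apply]
  let E : Quot (permOrbRel σ) ≃ Option (Quot (permOrbRel e)) :=
    { toFun := Quot.lift f fun _ _ => apply_eq_of_permOrbRel hf
      invFun := fun o => o.elim (Quot.mk _ 0)
        (Quot.lift g fun _ _ => apply_eq_of_permOrbRel hg)
      left_inv := by
        rintro ⟨x⟩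
        cases x using Fin.cases <;> rfl
      right_inv := by
        rintro (_ | x)
        · rfl
        · induction x using Quot.ind
          rfl }
  have : Finite (Quot (permOrbRel e)) := Finite.of_surjective _ Quot.mk_surjective
  rw [cycleCount, cycleCount, Nat.card_congr E, Finite.card_option]

/-- Inserting a new point into an existing cycle preserves the number of cycles. -/
theorem cycleCount_decomposeFin_symm_succ {n : ℕ} (q : Fin n) (e : Equiv.Perm (Fin n)) :
    cycleCount (Equiv.Perm.decomposeFin.symm (q.succ, e)) = cycleCount e := by
  set σ := Equiv.Perm.decomposeFin.symm (q.succ, e)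
  have hz : σ 0 = q.succ := Equiv.Perm.decomposeFin_symm_apply_zero q.succ e
  have hs (x : Fin n) : σ x.succ = if e x = q then 0 else (e x).succ := by
    simp [σ, Equiv.Perm.decomposeFin_symm_apply_succ, Equiv.swap_apply_def]
  let f : Fin (n + 1) → Quot (permOrbRel e) := Fin.cases (Quot.mk _ q) (Quot.mk _)
  have hf (x : Fin (n + 1)) : f (σ x) = f x := by
    cases x using Fin.cases with
    | zero => rw [hz]; rfl
    | succ x =>
      rw [hs]
      split_ifs with h
      · simp [f, ← h, quot_mk_permOrbRel_apply]
      · simp [f, quot_mk_permOrbRel_apply]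
  let g : Fin n → Quot (permOrbRel σ) := fun x => Quot.mk _ x.succ
  have hq : g q = Quot.mk _ 0 := by
    simp only [g, ← hz, quot_mk_permOrbRel_apply]
  have hg (x : Fin n) : g (e x) = g x := by
    have h := quot_mk_permOrbRel_apply σ x.succ
    rw [hs] at h
    split_ifs at h with hx
    · rw [hx, hq, h]
    · exact h
  refine Nat.card_congr
    { toFun := Quot.lift f fun _ _ => apply_eq_of_permOrbRel hf
      invFun := Quot.lift g fun _ _ => apply_eq_of_permOrbRel hg
      left_inv := ?_
      right_inv := ?_ }
  · rintro ⟨x⟩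
    cases x using Fin.cases with
    | zero => exact hq
    | succ x => rfl
  · rintro ⟨x⟩
    rfl

theorem sum_pow_cycleCount_succ (m n : ℕ) :
    ∑ β : Equiv.Perm (Fin (n + 1)), m ^ cycleCount β =
      (n + m) * ∑ β : Equiv.Perm (Fin n), m ^ cycleCount β := by
  rw [← Equiv.Perm.decomposeFin.symm.sum_comp, Fintype.sum_prod_type, Fin.sum_univ_succ]
  simp only [cycleCount_decomposeFin_symm_zero, cycleCount_decomposeFin_symm_succ, pow_succ,
    ← Finset.sum_mul, Finset.sum_const, Finset.card_univ, Fintype.card_fin, smul_eq_mul]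
  ring

/-- `Σ_{β ∈ S_r} (2^n)^{c(β)} = (r + 2^n - 1) · Σ_{β ∈ S_{r-1}} (2^n)^{c(β)}`. -/
theorem cycleIndex_eval_const_rec (n r : ℕ) (hn : 0 < n) (hr : 1 ≤ r) :
    ∑ β : Equiv.Perm (Fin r), (2 ^ n) ^ cycleCount β =
      (r + 2 ^ n - 1) * ∑ β : Equiv.Perm (Fin (r - 1)), (2 ^ n) ^ cycleCount β := by
  obtain ⟨k, rfl⟩ := Nat.exists_eq_add_of_le' hr
  rw [sum_pow_cycleCount_succ, Nat.add_right_comm, Nat.add_sub_cancel, Nat.add_sub_cancel]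
end

section
/- For all positive integers n and r with n < r, the number N(n,r) of unlabeled (n,r)-bipartite graphs satisfies n! · r! · N(n,r) ≥ Σ_{β ∈ S_r} 2^{n · c(β)}, where the sum is over all permutations β of Fin r and c(β) is the number of cycles of β including fixed points. (This expresses the inequality N(n,r) ≥ (1/n!) Z_{S_r}(2^n, …, 2^n).) -/
/-- The action of `S_n × S_r` on binary matrices by permuting rows and columns. -/
abbrev matrixAction (n r : ℕ) :
    MulAction (Equiv.Perm (Fin n) × Equiv.Perm (Fin r)) (Fin n → Fin r → Bool) where
  smul g M := fun i j => M (g.1⁻¹ i) (g.2⁻¹ j)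
  one_smul _ := rfl
  mul_smul g h M := by
    funext i j
    change M ((g.1 * h.1)⁻¹ i) ((g.2 * h.2)⁻¹ j) = M (h.1⁻¹ (g.1⁻¹ i)) (h.2⁻¹ (g.2⁻¹ j))
    simp only [mul_inv_rev, Equiv.Perm.mul_apply]

/-- A function invariant under a permutation takes equal values on related points. -/
theorem eq_of_permOrbRel {α γ : Type*} {σ : Equiv.Perm α} {f : α → γ}
    (hf : ∀ x, f (σ⁻¹ x) = f x) {x y : α} (h : permOrbRel σ x y) : f x = f y := by
  obtain ⟨k, rfl⟩ := h
  induction k with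
  | zero => simp
  | succ k ih =>
    rw [ih, add_comm, zpow_add, zpow_one, Equiv.Perm.mul_apply, ← hf (σ _)]
    simp
  | pred k ih =>
    rw [ih, sub_eq_neg_add, zpow_add, zpow_neg_one, Equiv.Perm.mul_apply, hf]

/-- Functions invariant under a permutation are functions on its set of cycles. -/
def invariantEquiv {α γ : Type*} (σ : Equiv.Perm α) :
    {f : α → γ // ∀ x, f (σ⁻¹ x) = f x} ≃ (Quot (permOrbRel σ) → γ) where
  toFun f := Quot.lift f.1 fun _ _ h => eq_of_permOrbRel f.2 h
  invFun g := ⟨fun x => g (Quot.mk _ x), fun x => congrArg g (Quot.sound ⟨1, by simp⟩)⟩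
  left_inv _ := rfl
  right_inv g := by
    funext q
    induction q using Quot.ind
    rfl

/-- The number of binary matrices fixed by a permutation `β` of the columns. -/
theorem card_column_fixed (n : ℕ) {r : ℕ} (β : Equiv.Perm (Fin r)) :
    Nat.card {M : Fin n → Fin r → Bool // ∀ i j, M i (β⁻¹ j) = M i j} =
      2 ^ (n * cycleCount β) := by
  have e : {M : Fin n → Fin r → Bool // ∀ i j, M i (β⁻¹ j) = M i j} ≃
      (Fin n → Quot (permOrbRel β) → Bool) :=
    Equiv.subtypePiEquivPi.trans (Equiv.piCongrRight fun _ => invariantEquiv β)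
  rw [Nat.card_congr e, Nat.card_fun, Nat.card_fun, Nat.card_fin, cycleCount, mul_comm, pow_mul]
  simp

/-- Burnside's lemma for `numBip`. -/
theorem sum_card_fixed_eq_numBip (n r : ℕ) :
    ∑ g : Equiv.Perm (Fin n) × Equiv.Perm (Fin r),
        Nat.card {M : Fin n → Fin r → Bool // ∀ i j, M (g.1⁻¹ i) (g.2⁻¹ j) = M i j} =
      Nat.factorial n * Nat.factorial r * numBip n r := by
  classical
  let _ := matrixAction n r
  have hb := MulAction.sum_card_fixedBy_eq_card_orbits_mul_card_group
    (Equiv.Perm (Fin n) × Equiv.Perm (Fin r)) (Fin n → Fin r → Bool)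
  have hq : numBip n r = Fintype.card (Quotient (MulAction.orbitRel
      (Equiv.Perm (Fin n) × Equiv.Perm (Fin r)) (Fin n → Fin r → Bool))) := by
    rw [← Nat.card_eq_fintype_card]
    refine Nat.card_congr (Quot.congrRight fun M M' => ?_)
    refine Iff.trans ?_ (Setoid.comm' _)
    refine Iff.trans ?_ MulAction.orbitRel_apply.symm
    constructor
    · rintro ⟨α, β, h⟩
      exact ⟨(α, β), funext fun i => funext fun j => (h i j).symm⟩
    · rintro ⟨g, rfl⟩
      exact ⟨g.1, g.2, fun _ _ => rfl⟩
  rw [Fintype.card_prod, Fintype.card_perm, Fintype.card_perm, Fintype.card_fin,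
    Fintype.card_fin, ← hq] at hb
  rw [mul_comm, ← hb]
  refine Finset.sum_congr rfl fun g _ => ?_
  rw [← Nat.card_eq_fintype_card]
  refine Nat.card_congr (Equiv.subtypeEquivRight fun M => ?_)
  exact ⟨fun h => funext fun i => funext fun j => h i j,
    fun h i j => congrFun (congrFun h i) j⟩

/-- For `0 < n < r`, `N(n,r) ≥ (1/n!) Z_{S_r}(2^n, …, 2^n)`, stated as
`n! · r! · N(n,r) ≥ Σ_{β ∈ S_r} 2^{n · c(β)}`. -/
theorem numBip_ge_cycleIndex (n r : ℕ) (hn : 0 < n) (hnr : n < r) :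
    ∑ β : Equiv.Perm (Fin r), 2 ^ (n * cycleCount β) ≤
      Nat.factorial n * Nat.factorial r * numBip n r := by
  rw [← sum_card_fixed_eq_numBip, Fintype.sum_prod_type]
  calc ∑ β : Equiv.Perm (Fin r), 2 ^ (n * cycleCount β)
      = ∑ β : Equiv.Perm (Fin r), Nat.card {M : Fin n → Fin r → Bool //
          ∀ i j, M ((1 : Equiv.Perm (Fin n))⁻¹ i) (β⁻¹ j) = M i j} :=
        Finset.sum_congr rfl fun β _ => (card_column_fixed n β).symm
    _ ≤ _ := Finset.single_le_sum (f := fun α : Equiv.Perm (Fin n) =>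
          ∑ β : Equiv.Perm (Fin r), Nat.card {M : Fin n → Fin r → Bool //
            ∀ i j, M (α⁻¹ i) (β⁻¹ j) = M i j})
        (fun _ _ => Nat.zero_le _) (Finset.mem_univ 1)
end

section
/- For any permutation α of Fin n and any permutation β of Fin r, the number of functions M : Fin n → Fin r → Bool satisfying M(α i)(β j) = M i j for all i and j equals 2^{c(α × β)}, where α × β is the permutation of Fin n × Fin r given by (i,j) ↦ (α i, β j) and c(α × β) is its number of cycles including fixed points. -/
theorem apply_zpow_eq_of_apply_eq {X B : Type*} {σ : Equiv.Perm X} {f : X → B}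
    (h : ∀ x, f (σ x) = f x) (k : ℤ) (x : X) : f ((σ ^ k) x) = f x := by
  induction k generalizing x with
  | zero => simp
  | succ k ih => rw [zpow_add_one, Equiv.Perm.mul_apply, ih, h]
  | pred k ih =>
    rw [zpow_sub_one, Equiv.Perm.mul_apply, ih, ← h, ← Equiv.Perm.mul_apply, mul_inv_cancel,
      Equiv.Perm.one_apply]

/-- Functions invariant under a permutation are the functions on its set of cycles. -/
def invariantFunEquiv {X : Type*} (σ : Equiv.Perm X) (B : Type*) :
    {f : X → B // ∀ x, f (σ x) = f x} ≃ (Quot (permOrbRel σ) → B) where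
  toFun f := Quot.lift f.1 fun x _ ⟨k, hk⟩ => hk ▸ (apply_zpow_eq_of_apply_eq f.2 k x).symm
  invFun g := ⟨fun x => g (Quot.mk _ x), fun x =>
    congrArg g (Quot.sound ⟨1, by rw [zpow_one]⟩).symm⟩
  left_inv _ := rfl
  right_inv g := by
    funext q
    induction q using Quot.ind
    rfl

theorem card_invariant_fun {X : Type*} [Finite X] (σ : Equiv.Perm X) (B : Type*) :
    Nat.card {f : X → B // ∀ x, f (σ x) = f x} = Nat.card B ^ cycleCount σ := by
  rw [Nat.card_congr (invariantFunEquiv σ B), Nat.card_fun, cycleCount]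

/-- The number of binary matrices fixed by the pair `(α, β)` is `2^{c(α × β)}`,
where `α × β` is the product permutation `(i, j) ↦ (α i, β j)`. -/
theorem card_fixed_matrices (n r : ℕ) (α : Equiv.Perm (Fin n)) (β : Equiv.Perm (Fin r)) :
    Nat.card {M : Fin n → Fin r → Bool // ∀ i j, M (α i) (β j) = M i j} =
      2 ^ cycleCount (Equiv.prodCongr α β) := by
  have card_bool : Nat.card Bool = 2 := by simp
  rw [← card_bool, ← card_invariant_fun]
  exact Nat.card_congr ((Equiv.curry (Fin n) (Fin r) Bool).symm.subtypeEquiv fun M =>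
    (Prod.forall (p := fun x : Fin n × Fin r =>
      M (α x.1) (β x.2) = M x.1 x.2)).symm)
end

section
/- For any permutation α of Fin n and any permutation β of Fin r, the number of cycles (including fixed points) of the product permutation α × β of Fin n × Fin r equals the sum, over all pairs consisting of a cycle d of α (including fixed points as cycles of length 1) and a cycle c of β (including fixed points as cycles of length 1), of gcd(length of d, length of c). Equivalently, c(α × β) = Σ_{k=1}^{n} Σ_{j=1}^{r} p_k(α) · q_j(β) · gcd(k, j), where p_k(α) and q_j(β) are the numbers of cycles of length k of α and of length j of β, respectively. -/
theorem quot_mk_permOrbRel_eq_iff {α : Type*} (σ : Equiv.Perm α) (x y : α) :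
    Quot.mk (permOrbRel σ) y = Quot.mk (permOrbRel σ) x ↔
      y ∈ MulAction.orbit (Subgroup.zpowers σ) x := by
  constructor
  · intro h
    have hmk := congrArg (Quot.lift
      (fun z => MulAction.orbit (Subgroup.zpowers σ) z) fun a b ⟨k, hk⟩ => by
        refine (MulAction.orbit_eq_iff.mpr ?_).symm
        exact ⟨⟨σ ^ k, k, rfl⟩, hk⟩) h
    exact MulAction.orbit_eq_iff.mp hmk
  · rintro ⟨⟨_, k, rfl⟩, hk⟩
    exact (Quot.sound ⟨k, hk⟩).symm

theorem orbSize_mk {α : Type*} (σ : Equiv.Perm α) (x : α) :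
    orbSize (Quot.mk (permOrbRel σ) x) = Function.minimalPeriod σ x := by
  rw [orbSize, Nat.card_congr ((Equiv.subtypeEquivRight (quot_mk_permOrbRel_eq_iff σ x)).trans
    (MulAction.orbitZPowersEquiv σ x)), Nat.card_zmod]
  rfl

theorem orbSize_ne_zero {α : Type*} [Finite α] {r : α → α → Prop} (q : Quot r) :
    orbSize q ≠ 0 := by
  obtain ⟨x, rfl⟩ := Quot.exists_rep q
  have : Nonempty {y // Quot.mk r y = Quot.mk r x} := ⟨⟨x, rfl⟩⟩
  exact Nat.card_pos.ne'

/-- Weighting each point by the inverse of the size of its class turns a sum over points into a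
sum over classes. -/
theorem sum_div_orbSize {α : Type*} [Fintype α] {r : α → α → Prop} [Fintype (Quot r)]
    (f : Quot r → ℚ) :
    ∑ x, f (Quot.mk r x) / orbSize (Quot.mk r x) = ∑ q, f q := by
  classical
  rw [← Fintype.sum_fiberwise (Quot.mk r)]
  refine Finset.sum_congr rfl fun q _ => ?_
  have hcard : Fintype.card {x // Quot.mk r x = q} = orbSize q := by
    rw [orbSize, Nat.card_eq_fintype_card]
  have hq : (orbSize q : ℚ) ≠ 0 := Nat.cast_ne_zero.mpr (orbSize_ne_zero q)
  rw [Finset.sum_congr rfl fun (x : {x // Quot.mk r x = q}) _ =>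
    show f (Quot.mk r x) / orbSize (Quot.mk r x.1) = f q / orbSize q by rw [x.2]]
  rw [Finset.sum_const, Finset.card_univ, hcard, nsmul_eq_mul]
  field_simp

theorem cycleCount_eq_sum_inv_minimalPeriod {α : Type*} [Fintype α] (σ : Equiv.Perm α) :
    (cycleCount σ : ℚ) = ∑ x, (Function.minimalPeriod σ x : ℚ)⁻¹ := by
  have := Fintype.ofFinite (Quot (permOrbRel σ))
  have h := sum_div_orbSize (r := permOrbRel σ) fun _ => 1
  simp only [orbSize_mk, one_div] at h
  rw [h, cycleCount, Nat.card_eq_fintype_card]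
  simp

/-- The number of cycles of the product permutation `α × β` equals the sum,
over all pairs of a cycle `d` of `α` and a cycle `c` of `β` (fixed points
counted as cycles of length 1), of `gcd(length d, length c)`. -/
theorem cycleCount_prodCongr (n r : ℕ) (α : Equiv.Perm (Fin n)) (β : Equiv.Perm (Fin r)) :
    cycleCount (Equiv.prodCongr α β) =
      ∑ᶠ d : Quot (permOrbRel α), ∑ᶠ c : Quot (permOrbRel β),
        Nat.gcd (orbSize d) (orbSize c) := by
  have := Fintype.ofFinite (Quot (permOrbRel α))
  have := Fintype.ofFinite (Quot (permOrbRel β))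
  simp only [finsum_eq_sum_of_fintype]
  apply Nat.cast_injective (R := ℚ)
  rw [cycleCount_eq_sum_inv_minimalPeriod, Fintype.sum_prod_type]
  push_cast
  rw [← sum_div_orbSize]
  refine Finset.sum_congr rfl fun x _ => ?_
  rw [← sum_div_orbSize, Finset.sum_div]
  refine Finset.sum_congr rfl fun y _ => ?_
  have hx := orbSize_ne_zero (Quot.mk (permOrbRel α) x)
  have hy := orbSize_ne_zero (Quot.mk (permOrbRel β) y)
  rw [orbSize_mk] at hx hy
  rw [orbSize_mk, orbSize_mk, show ⇑(Equiv.prodCongr α β) = Prod.map α β from rfl,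
    Function.minimalPeriod_prodMap]
  have hlcm := Nat.lcm_ne_zero hx hy
  have hmul := congrArg (Nat.cast (R := ℚ)) (Nat.gcd_mul_lcm
    (Function.minimalPeriod α x) (Function.minimalPeriod β y))
  push_cast at hmul
  field_simp
  linear_combination -hmul
end

section
/- Let n be a positive integer, σ a permutation of Fin n that is not the identity, with p_k cycles of length k (fixed points counted as cycles of length 1), and let α ≥ 2 be an integer. If Σ_{k=1}^{n} p_k · gcd(k, α + 1) = n, then Σ_{k=1}^{n} p_k · gcd(k, α) ≤ n - 1. -/
/-- `p_k(σ)`: the number of cycles of length `k` of `σ`, fixed points counted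
as cycles of length 1. -/
noncomputable def pCount {n : ℕ} (σ : Equiv.Perm (Fin n)) (k : ℕ) : ℕ :=
  Nat.card {d : Quot (permOrbRel σ) // orbSize d = k}

theorem orbSize_le_card {n : ℕ} {r : Fin n → Fin n → Prop} (q : Quot r) : orbSize q ≤ n := by
  simpa [orbSize] using Finite.card_subtype_le (fun x : Fin n => Quot.mk r x = q)

theorem orbSize_pos {α : Type*} [Finite α] {r : α → α → Prop} (q : Quot r) : 0 < orbSize q := by
  obtain ⟨x, rfl⟩ := Quot.exists_rep q
  exact @Nat.card_pos _ ⟨⟨x, rfl⟩⟩ _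

theorem sum_orbSize {n : ℕ} {r : Fin n → Fin n → Prop} [Fintype (Quot r)] :
    ∑ q : Quot r, orbSize q = n := by
  have hcard := Nat.card_congr (Equiv.sigmaFiberEquiv (Quot.mk r))
  rw [Nat.card_sigma] at hcard
  simpa [orbSize] using hcard

theorem sum_pCount_mul {n : ℕ} (σ : Equiv.Perm (Fin n)) :
    ∑ k ∈ Finset.Icc 1 n, pCount σ k * k = n := by
  classical
  have : Fintype (Quot (permOrbRel σ)) := Fintype.ofFinite _
  have hmaps : ∀ q ∈ (Finset.univ : Finset (Quot (permOrbRel σ))),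
      orbSize q ∈ Finset.Icc 1 n := fun q _ =>
    Finset.mem_Icc.2 ⟨orbSize_pos q, orbSize_le_card q⟩
  refine Eq.trans ?_ (sum_orbSize (r := permOrbRel σ))
  rw [← Finset.sum_fiberwise_of_maps_to hmaps]
  refine Finset.sum_congr rfl fun k _ => ?_
  rw [Finset.sum_congr rfl fun q hq => (Finset.mem_filter.1 hq).2]
  simp [pCount, Fintype.card_subtype]

theorem exists_pCount_pos_of_ne_one {n : ℕ} {σ : Equiv.Perm (Fin n)} (hσ : σ ≠ 1) :
    ∃ k ∈ Finset.Icc 1 n, 2 ≤ k ∧ 0 < pCount σ k := by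
  obtain ⟨x, hx⟩ : ∃ x, σ x ≠ x := by
    by_contra! hfix
    exact hσ (Equiv.ext hfix)
  let q := Quot.mk (permOrbRel σ) x
  refine ⟨orbSize q, Finset.mem_Icc.2 ⟨orbSize_pos q, orbSize_le_card q⟩, ?_, ?_⟩
  · have hq : Quot.mk (permOrbRel σ) (σ x) = q := (Quot.sound ⟨1, by simp⟩).symm
    have : Nontrivial {y // Quot.mk (permOrbRel σ) y = q} :=
      ⟨⟨σ x, hq⟩, ⟨x, rfl⟩, fun heq => hx (congrArg Subtype.val heq)⟩
    exact Finite.one_lt_card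
  · exact @Nat.card_pos _ ⟨⟨q, rfl⟩⟩ _

/-- If `n ≤ Σ p_k · gcd(k, b)`, then every cycle length of `σ` divides `b`. -/
theorem dvd_of_le_sum_gcd {n : ℕ} {σ : Equiv.Perm (Fin n)} {b : ℕ}
    (h : n ≤ ∑ k ∈ Finset.Icc 1 n, pCount σ k * Nat.gcd k b)
    {k : ℕ} (hk : k ∈ Finset.Icc 1 n) (hp : 0 < pCount σ k) : k ∣ b := by
  have hle : ∀ j ∈ Finset.Icc 1 n, pCount σ j * Nat.gcd j b ≤ pCount σ j * j := fun j hj =>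
    Nat.mul_le_mul_left _ (Nat.gcd_le_left b (Finset.mem_Icc.1 hj).1)
  have heq := (Finset.sum_eq_sum_iff_of_le hle).1
    (le_antisymm (Finset.sum_le_sum hle) ((sum_pCount_mul σ).trans_le h)) k hk
  exact Nat.gcd_eq_left_iff_dvd.1 (Nat.eq_of_mul_eq_mul_left hp heq)

/-- If `σ ≠ 1` and `Σ_{k=1}^{n} p_k · gcd(k, a + 1) = n` for some integer
`a ≥ 2`, then `Σ_{k=1}^{n} p_k · gcd(k, a) ≤ n - 1`. -/
theorem gcd_sum_le_of_eq (n : ℕ) (hn : 0 < n) (σ : Equiv.Perm (Fin n)) (hσ : σ ≠ 1)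
    (a : ℕ) (ha : 2 ≤ a)
    (h : ∑ k ∈ Finset.Icc 1 n, pCount σ k * Nat.gcd k (a + 1) = n) :
    ∑ k ∈ Finset.Icc 1 n, pCount σ k * Nat.gcd k a ≤ n - 1 := by
  obtain ⟨k, hk, hk2, hp⟩ := exists_pCount_pos_of_ne_one hσ
  by_contra hlt
  have hdvd : k ∣ a := dvd_of_le_sum_gcd (by omega) hk hp
  have hdvd' : k ∣ a + 1 := dvd_of_le_sum_gcd h.ge hk hp
  have hone : k ∣ 1 := (Nat.dvd_add_right hdvd).1 hdvd'
  have := Nat.le_of_dvd one_pos hone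
  omega
end

section
/- For every positive integer n, the number of equivalence classes of n×n binary matrices under the equivalence generated by row permutations, column permutations, and matrix transposition is at least C(n + 2^n - 1, n) / (2 · n!); equivalently, 2 · n! times this number of classes is at least C(n + 2^n - 1, n), where C(a,b) denotes the binomial coefficient. -/
/-- One elementary move on `n × n` binary matrices: a permutation of the rows,
a permutation of the columns, or taking the transpose. The equivalence classes
of the equivalence relation generated by this relation (i.e. the elements of
`Quot (matMove n)`) are the classes of matrices under row permutations, column
permutations and transposition. -/
def matMove (n : ℕ) (M M' : Fin n → Fin n → Bool) : Prop :=
  (∃ α : Equiv.Perm (Fin n), ∀ i j, M' i j = M (α i) j) ∨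
  (∃ β : Equiv.Perm (Fin n), ∀ i j, M' i j = M i (β j)) ∨
  (∀ i j, M' i j = M j i)

/-- The multiset of rows of a matrix with `n` rows. -/
def rowSym {α : Type*} {n : ℕ} (M : Fin n → α) : Sym α n :=
  ⟨Finset.univ.val.map M, by simp⟩

theorem rowSym_surjective {α : Type*} {n : ℕ} :
    Function.Surjective (rowSym : (Fin n → α) → Sym α n) := by
  rintro ⟨s, hs⟩
  induction s using Quotient.inductionOn with
  | h l =>
    have hl : l.length = n := by simpa using hs
    subst hl
    refine ⟨l.get, Subtype.ext ?_⟩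
    simp [rowSym, Fin.univ_val_map]

theorem rowSym_comp_perm {α : Type*} {n : ℕ} (M : Fin n → α) (σ : Equiv.Perm (Fin n)) :
    rowSym (M ∘ σ) = rowSym M := by
  apply Subtype.ext
  change Finset.univ.val.map (M ∘ σ) = Finset.univ.val.map M
  rw [← Multiset.map_map, Multiset.map_univ_val_equiv]

/-- Matrices equivalent under the moves differ by one row permutation and one column permutation,
possibly followed by a transposition. -/
theorem exists_perm_of_eqvGen_matMove {n : ℕ} {M M' : Fin n → Fin n → Bool}
    (h : Relation.EqvGen (matMove n) M M') :
    ∃ α β : Equiv.Perm (Fin n),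
      (∀ i j, M' i j = M (α i) (β j)) ∨ (∀ i j, M' i j = M (α j) (β i)) := by
  induction h with
  | rel M M' h =>
    rcases h with ⟨α, h⟩ | ⟨β, h⟩ | h
    · exact ⟨α, 1, Or.inl h⟩
    · exact ⟨1, β, Or.inl h⟩
    · exact ⟨1, 1, Or.inr h⟩
  | refl M => exact ⟨1, 1, Or.inl fun _ _ => rfl⟩
  | symm M M' _ ih =>
    obtain ⟨α, β, h | h⟩ := ih
    · exact ⟨α.symm, β.symm, Or.inl fun i j => by simp [h]⟩
    · exact ⟨β.symm, α.symm, Or.inr fun i j => by simp [h]⟩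
  | trans M M' M'' _ _ ih ih' =>
    obtain ⟨α, β, h | h⟩ := ih <;> obtain ⟨γ, δ, h' | h'⟩ := ih'
    · exact ⟨γ.trans α, δ.trans β, Or.inl fun i j => by simp [h, h']⟩
    · exact ⟨γ.trans α, δ.trans β, Or.inr fun i j => by simp [h, h']⟩
    · exact ⟨δ.trans α, γ.trans β, Or.inr fun i j => by simp [h, h']⟩
    · exact ⟨δ.trans α, γ.trans β, Or.inl fun i j => by simp [h, h']⟩

/-- The multiset of rows obtained from the chosen representative of a class by optionally
transposing it and then permuting its columns. -/
noncomputable def classRowSym (n : ℕ) (p : (Bool × Equiv.Perm (Fin n)) × Quot (matMove n)) :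
    Sym (Fin n → Bool) n :=
  rowSym fun i j => if p.1.1 then p.2.out (p.1.2 j) i else p.2.out i (p.1.2 j)

theorem classRowSym_surjective (n : ℕ) : Function.Surjective (classRowSym n) := by
  intro s
  obtain ⟨M, rfl⟩ := rowSym_surjective s
  obtain ⟨α, β, h | h⟩ := exists_perm_of_eqvGen_matMove
    (Quot.eqvGen_exact (Quot.out_eq (Quot.mk (matMove n) M)))
  · refine ⟨((false, β), Quot.mk _ M), ?_⟩
    rw [classRowSym, ← rowSym_comp_perm _ α]
    congr 1
    funext i j
    simp [h i j]
  · refine ⟨((true, α), Quot.mk _ M), ?_⟩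
    rw [classRowSym, ← rowSym_comp_perm _ β]
    congr 1
    funext i j
    simp [h i j]

/-- The number of equivalence classes of `n × n` binary matrices under the
equivalence generated by row permutations, column permutations and matrix
transposition is at least `C(n + 2^n - 1, n) / (2 · n!)`, stated as
`C(n + 2^n - 1, n) ≤ 2 · n! · #classes`. -/
theorem square_classes_lower_bound (n : ℕ) (hn : 0 < n) :
    Nat.choose (n + 2 ^ n - 1) n ≤
      2 * Nat.factorial n * Nat.card (Quot (matMove n)) := by
  have : Finite (Quot (matMove n)) := Finite.of_surjective _ Quot.mk_surjective
  have hcard := Nat.card_le_card_of_surjective _ (classRowSym_surjective n)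
  simpa [Nat.card_eq_fintype_card, Nat.card_prod, Sym.card_sym_eq_choose, Fintype.card_perm,
    add_comm] using hcard
end
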